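/- arXiv:1802.04077 — 2 statements merged into one kernel-verified Lean document; each statement's English description precedes it below -/
import Mathlib

section
/- Let α be a real number with α ∉ ℤ, let X be c₀(Δ^(α)) or ℓ∞(Δ^(α)), and suppose the infinite matrix A = (a_{nk}) maps X into c (the space of convergent sequences with the supremum norm). Then the bounded linear operator L_A : X → c, L_A(x) = Ax, is a compact operator if and only if lim_{r→∞} sup_{n≥r} ∑_{k=0}^∞ |â_{nk} − α̂_k| = 0, where â_{nk} = ∑_{j=k}^∞ (−1)^{j−k} Γ(−α+1)/((j−k)!·Γ(−α−j+k+1)) a_{nj} and α̂_k = lim_{n→∞} â_{nk} (which exists for each k). -/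
open Filter Finset Topology

/-- The fractional difference matrix `Δ^(α)`. -/
noncomputable def fracDelta (α : ℝ) (n k : ℕ) : ℝ :=
  if k ≤ n then
    (-1 : ℝ) ^ (n - k) * Real.Gamma (α + 1) /
      ((Nat.factorial (n - k) : ℝ) * Real.Gamma (α - n + k + 1))
  else 0

/-- `(Δ^(α)x)_n = ∑_{k=0}^n Δ^(α)_{nk} x_k`. -/
noncomputable def fracDeltaSeq (α : ℝ) (x : ℕ → ℝ) (n : ℕ) : ℝ :=
  ∑ k ∈ Finset.range (n + 1), fracDelta α n k * x k

/-- Membership in `c₀(Δ^(α))`. -/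
def memC0Delta (α : ℝ) (x : ℕ → ℝ) : Prop :=
  Tendsto (fracDeltaSeq α x) atTop (nhds 0)

/-- Membership in `ℓ∞(Δ^(α))`. -/
def memLinfDelta (α : ℝ) (x : ℕ → ℝ) : Prop :=
  ∃ C : ℝ, ∀ n, |fracDeltaSeq α x n| ≤ C

/-- The norm `‖x‖ = sup_n |(Δ^(α)x)_n|`. -/
noncomputable def deltaNorm (α : ℝ) (x : ℕ → ℝ) : ℝ :=
  ⨆ n, |fracDeltaSeq α x n|

/-- Classical convergence of the series `∑_{j=0}^∞ f j` to `L`. -/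
def SeriesHasSum (f : ℕ → ℝ) (L : ℝ) : Prop :=
  Tendsto (fun m => ∑ j ∈ Finset.range m, f j) atTop (nhds L)

/-- `(Ax)_n = ∑_k a_{nk} x_k` (the limit of the partial sums, when it exists). -/
noncomputable def matMul (a : ℕ → ℕ → ℝ) (x : ℕ → ℝ) (n : ℕ) : ℝ :=
  limUnder atTop (fun m => ∑ k ∈ Finset.range m, a n k * x k)


lemma fd_gamma (α : ℝ) (hα : ∀ m : ℤ, α ≠ (m : ℝ)) (m : ℕ) :
    Real.Gamma (α + 1) = (descPochhammer ℤ m).smeval α * Real.Gamma (α - m + 1) := by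
  induction m with
  | zero => simp
  | succ m ih =>
    have h1 : α - m ≠ 0 := by
      intro h
      exact hα m (by push_cast; linarith)
    rw [ih, descPochhammer_succ_right, Polynomial.smeval_mul, Real.Gamma_add_one h1]
    have : α - ((m + 1 : ℕ) : ℝ) + 1 = α - m := by push_cast; ring
    rw [this]
    simp [Polynomial.smeval_sub, Polynomial.smeval_natCast]
    ring

lemma fd_gamma_ne (α : ℝ) (hα : ∀ m : ℤ, α ≠ (m : ℝ)) (m : ℕ) :
    Real.Gamma (α - m + 1) ≠ 0 := by
  apply Real.Gamma_ne_zero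
  intro k h
  apply hα (m - 1 - k)
  push_cast
  linarith

lemma fd_choose (α : ℝ) (hα : ∀ m : ℤ, α ≠ (m : ℝ)) (n k : ℕ) (h : k ≤ n) :
    fracDelta α n k = (-1 : ℝ) ^ (n - k) * Ring.choose α (n - k) := by
  obtain ⟨j, rfl⟩ := Nat.exists_eq_add_of_le h
  have h0 : α - ((k + j : ℕ) : ℝ) + k + 1 = α - j + 1 := by push_cast; ring
  have h1 := fd_gamma_ne α hα j
  have h2 : (Nat.factorial j : ℝ) ≠ 0 := by positivity
  rw [fracDelta, if_pos h, h0, Nat.add_sub_cancel_left, fd_gamma α hα j, Ring.choose_eq_smul]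
  simp only [smul_eq_mul]
  field_simp

/-- signed generalised binomial coefficient -/
noncomputable def sbin (α : ℝ) (m : ℕ) : ℝ := (-1 : ℝ) ^ m * Ring.choose α m

lemma sbin_conv (α : ℝ) (m : ℕ) :
    ∑ p ∈ HasAntidiagonal.antidiagonal m, sbin α p.1 * sbin (-α) p.2 = if m = 0 then 1 else 0 := by
  have h := Ring.add_choose_eq (r := α) (s := -α) m (Commute.all _ _)
  rw [add_neg_cancel, Ring.choose_zero_ite] at h
  have h2 : ∑ p ∈ HasAntidiagonal.antidiagonal m, sbin α p.1 * sbin (-α) p.2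
      = (-1 : ℝ) ^ m * ∑ p ∈ HasAntidiagonal.antidiagonal m, Ring.choose α p.1 * Ring.choose (-α) p.2 := by
    rw [Finset.mul_sum]
    refine Finset.sum_congr rfl fun p hp => ?_
    rw [← HasAntidiagonal.mem_antidiagonal.1 hp, sbin, sbin, pow_add]
    ring
  rw [h2, ← h]
  split_ifs with h3 <;> simp [h3]

lemma fds_eq (α : ℝ) (hα : ∀ m : ℤ, α ≠ (m : ℝ)) (x : ℕ → ℝ) (n : ℕ) :
    fracDeltaSeq α x n = ∑ p ∈ HasAntidiagonal.antidiagonal n, sbin α p.1 * x p.2 := by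
  rw [fracDeltaSeq, Finset.Nat.sum_antidiagonal_eq_sum_range_succ_mk, ← Finset.sum_range_reflect]
  refine Finset.sum_congr rfl fun k hk => ?_
  have hk' : k ≤ n := by simpa [Nat.lt_succ_iff] using hk
  simp only [Nat.add_sub_cancel]
  rw [fd_choose α hα _ _ (Nat.sub_le _ _), sbin]
  have : n - (n - k) = k := by omega
  rw [this]

lemma fds_inv (α : ℝ) (hα : ∀ m : ℤ, α ≠ (m : ℝ)) (y : ℕ → ℝ) :
    fracDeltaSeq α (fracDeltaSeq (-α) y) = y := by
  have hα' : ∀ m : ℤ, -α ≠ (m : ℝ) := by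
    intro m h
    exact hα (-m) (by push_cast; linarith)
  funext n
  have h := PowerSeries.coeff_mul n (PowerSeries.mk (sbin α) * PowerSeries.mk (sbin (-α)))
    (PowerSeries.mk y)
  have h1 : PowerSeries.mk (sbin α) * PowerSeries.mk (sbin (-α)) = 1 := by
    ext m
    rw [PowerSeries.coeff_mul, PowerSeries.coeff_one]
    simpa using sbin_conv α m
  have h2 : PowerSeries.mk (sbin (-α)) * PowerSeries.mk y
      = PowerSeries.mk (fracDeltaSeq (-α) y) := by
    ext m
    rw [PowerSeries.coeff_mul]
    simp [fds_eq (-α) hα']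
  have h3 : PowerSeries.mk (sbin α) * PowerSeries.mk (fracDeltaSeq (-α) y)
      = PowerSeries.mk y := by
    rw [← h2, ← mul_assoc, h1, one_mul]
  have h4 := congrArg (PowerSeries.coeff n) h3
  rw [PowerSeries.coeff_mul] at h4
  simpa [fds_eq α hα] using h4

/-- sign with values `±1` -/
noncomputable def sg (x : ℝ) : ℝ := if 0 ≤ x then 1 else -1

lemma mul_sg (x : ℝ) : x * sg x = |x| := by
  unfold sg
  split_ifs with h
  · rw [abs_of_nonneg h, mul_one]
  · rw [abs_of_neg (not_le.1 h)]; ring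

lemma abs_sg (x : ℝ) : |sg x| = 1 := by
  unfold sg
  split_ifs <;> simp

lemma summ_mul {b y : ℕ → ℝ} (hb : Summable fun i => |b i|) {C : ℝ} (hy : ∀ i, |y i| ≤ C) :
    Summable fun i => |b i * y i| := by
  refine Summable.of_nonneg_of_le (fun i => abs_nonneg _) (fun i => ?_) (hb.mul_right C)
  rw [abs_mul]
  exact mul_le_mul_of_nonneg_left (hy i) (abs_nonneg _)

lemma tsum_mul_le {b y : ℕ → ℝ} (hb : Summable fun i => |b i|) {C : ℝ} (hy : ∀ i, |y i| ≤ C) :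
    |∑' i, b i * y i| ≤ C * ∑' i, |b i| := by
  have h := tsum_of_norm_bounded (f := fun i => b i * y i) (hb.hasSum.mul_left C) (fun i => by
    rw [Real.norm_eq_abs, abs_mul, mul_comm]
    exact mul_le_mul_of_nonneg_right (hy i) (abs_nonneg _))
  exact h

lemma tsum_cut (b s : ℕ → ℝ) (K : ℕ) :
    ∑' i, b i * (if i < K then s i else 0) = ∑ i ∈ Finset.range K, b i * s i := by
  rw [tsum_eq_sum (s := Finset.range K)]
  · refine Finset.sum_congr rfl fun i hi => ?_
    rw [if_pos (Finset.mem_range.1 hi)]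
  · intro i hi
    rw [if_neg (by simpa using hi), mul_zero]

lemma cut_tendsto (s : ℕ → ℝ) (K : ℕ) :
    Tendsto (fun i => if i < K then s i else 0) atTop (𝓝 0) := by
  refine tendsto_const_nhds.congr' ?_
  filter_upwards [eventually_ge_atTop K] with i hi
  rw [if_neg (not_lt.2 hi)]

lemma bdd_of_tendsto {y : ℕ → ℝ} {L : ℝ} (h : Tendsto y atTop (𝓝 L)) : ∃ C, ∀ i, |y i| ≤ C := by
  obtain ⟨C, hC⟩ := h.abs.bddAbove_range
  exact ⟨C, fun i => hC ⟨i, rfl⟩⟩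

open ZeroAtInfty in
lemma bs_bound (c : ℕ → ℕ → ℝ) (hs : ∀ m, Summable fun i => |c m i|)
    (hc : ∀ y : ℕ → ℝ, Tendsto y atTop (𝓝 0) →
      ∃ L, Tendsto (fun m => ∑' i, c m i * y i) atTop (𝓝 L)) :
    ∃ M, ∀ m, ∑' i, |c m i| ≤ M := by
  have hle : ∀ (y : C₀(ℕ, ℝ)) i, |y i| ≤ ‖y‖ := fun y i => y.toBCF.norm_coe_le_norm i
  let f : ℕ → C₀(ℕ, ℝ) →L[ℝ] ℝ := fun m =>
    LinearMap.mkContinuous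
      { toFun := fun y => ∑' i, c m i * y i
        map_add' := fun y z => by
          simp only [ZeroAtInftyContinuousMap.coe_add, Pi.add_apply, mul_add]
          exact (summ_mul (hs m) (hle y)).of_abs.tsum_add (summ_mul (hs m) (hle z)).of_abs
        map_smul' := fun r y => by
          simp only [ZeroAtInftyContinuousMap.coe_smul, Pi.smul_apply, smul_eq_mul,
            RingHom.id_apply, ← tsum_mul_left]
          exact tsum_congr fun i => by ring }
      (∑' i, |c m i|) (fun y => by
        have := tsum_mul_le (hs m) (hle y)
        exact this.trans (le_of_eq (mul_comm _ _)))
  have hf : ∀ m y, f m y = ∑' i, c m i * y i := fun m y => rfl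
  obtain ⟨M, hM⟩ := banach_steinhaus (g := f) (fun y => by
    have hy : Tendsto (y : ℕ → ℝ) atTop (𝓝 0) := by
      have := y.zero_at_infty'
      rw [cocompact_eq_cofinite, Nat.cofinite_eq_atTop] at this
      exact this
    obtain ⟨L, hL⟩ := hc y hy
    obtain ⟨C, hC⟩ := bdd_of_tendsto hL
    exact ⟨C, fun m => hC m⟩)
  refine ⟨M, fun m => Real.tsum_le_of_sum_range_le (fun i => abs_nonneg _) fun K => ?_⟩
  have h0 := cut_tendsto (fun i => sg (c m i)) K
  let y : C₀(ℕ, ℝ) := ⟨⟨fun i => if i < K then sg (c m i) else 0, continuous_of_discreteTopology⟩,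
    by rw [cocompact_eq_cofinite, Nat.cofinite_eq_atTop]; exact h0⟩
  have hy : ‖y‖ ≤ 1 := by
    rw [← ZeroAtInftyContinuousMap.norm_toBCF_eq_norm]
    refine (BoundedContinuousFunction.norm_le zero_le_one).2 fun i => ?_
    change |if i < K then sg (c m i) else 0| ≤ 1
    split_ifs
    · exact (abs_sg _).le
    · simp
  have h1 : f m y = ∑ i ∈ Finset.range K, |c m i| := by
    rw [hf]
    refine (tsum_cut (c m) (fun i => sg (c m i)) K).trans ?_
    exact Finset.sum_congr rfl fun i _ => mul_sg _
  calc ∑ i ∈ Finset.range K, |c m i| = f m y := h1.symm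
    _ ≤ ‖f m y‖ := Real.le_norm_self _
    _ ≤ ‖f m‖ * ‖y‖ := (f m).le_opNorm y
    _ ≤ M * 1 := mul_le_mul (hM m) hy (norm_nonneg _) ((norm_nonneg _).trans (hM m))
    _ = M := mul_one M

lemma lim_summable {c : ℕ → ℕ → ℝ} (hs : ∀ m, Summable fun i => |c m i|) {M : ℝ}
    (hM : ∀ m, ∑' i, |c m i| ≤ M) {β : ℕ → ℝ} (hβ : ∀ i, Tendsto (fun m => c m i) atTop (𝓝 (β i))) :
    (Summable fun i => |β i|) ∧ ∑' i, |β i| ≤ M := by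
  have h : ∀ K, ∑ i ∈ Finset.range K, |β i| ≤ M := fun K => by
    refine le_of_tendsto (tendsto_finsetSum _ fun i _ => (hβ i).abs) (Eventually.of_forall fun m => ?_)
    exact ((hs m).sum_le_tsum _ fun i _ => abs_nonneg _).trans (hM m)
  exact ⟨summable_of_sum_range_le (fun i => abs_nonneg _) h,
    Real.tsum_le_of_sum_range_le (fun i => abs_nonneg _) h⟩

lemma c0_conv {c : ℕ → ℕ → ℝ} (hs : ∀ m, Summable fun i => |c m i|) {M : ℝ}
    (hM : ∀ m, ∑' i, |c m i| ≤ M) {β : ℕ → ℝ} (hβ : ∀ i, Tendsto (fun m => c m i) atTop (𝓝 (β i)))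
    {y : ℕ → ℝ} (hy : Tendsto y atTop (𝓝 0)) :
    Tendsto (fun m => ∑' i, c m i * y i) atTop (𝓝 (∑' i, β i * y i)) := by
  obtain ⟨hbs, hbM⟩ := lim_summable hs hM hβ
  obtain ⟨C, hC⟩ := bdd_of_tendsto hy
  have hM0 : 0 ≤ M := (tsum_nonneg fun i => abs_nonneg _).trans (hM 0)
  rw [Metric.tendsto_atTop]
  intro ε hε
  have hδ : 0 < ε / (4 * (M + 1)) := by positivity
  obtain ⟨K, hK⟩ := (Metric.tendsto_atTop.1 hy) _ hδ
  have hds : ∀ m, Summable fun i => |c m i - β i| := fun m => by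
    refine Summable.of_nonneg_of_le (fun i => abs_nonneg _) (fun i => abs_sub _ _) ((hs m).add hbs)
  have hdM : ∀ m, ∑' i, |c m i - β i| ≤ 2 * M := fun m => by
    calc ∑' i, |c m i - β i| ≤ ∑' i, (|c m i| + |β i|) :=
          (hds m).tsum_le_tsum (fun i => abs_sub _ _) ((hs m).add hbs)
      _ = _ := (hs m).tsum_add hbs
      _ ≤ 2 * M := by linarith [hM m]
  have hfin : Tendsto (fun m => ∑ i ∈ Finset.range K, (c m i - β i) * y i) atTop (𝓝 0) := by
    have : Tendsto (fun m => ∑ i ∈ Finset.range K, (c m i - β i) * y i) atTop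
        (𝓝 (∑ i ∈ Finset.range K, (β i - β i) * y i)) :=
      tendsto_finsetSum _ fun i _ => ((hβ i).sub_const _).mul_const _
    simpa using this
  obtain ⟨N, hN⟩ := (Metric.tendsto_atTop.1 hfin) (ε / 4) (by positivity)
  refine ⟨N, fun m hm => ?_⟩
  have h1 : ∑' i, c m i * y i - ∑' i, β i * y i = ∑' i, (c m i - β i) * y i := by
    rw [← (summ_mul (hs m) hC).of_abs.tsum_sub (summ_mul hbs hC).of_abs]
    exact tsum_congr fun i => by ring
  have h2 : ∑' i, (c m i - β i) * y i = ∑ i ∈ Finset.range K, (c m i - β i) * y i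
      + ∑' i, (c m i - β i) * (if i < K then 0 else y i) := by
    rw [← tsum_cut (fun i => c m i - β i) y K, ← Summable.tsum_add]
    · refine tsum_congr fun i => ?_
      split_ifs <;> ring
    · refine (summ_mul (hds m) (C := C) fun i => ?_).of_abs
      split_ifs
      · exact hC i
      · simpa using (abs_nonneg _).trans (hC 0)
    · refine (summ_mul (hds m) (C := C) fun i => ?_).of_abs
      split_ifs
      · simpa using (abs_nonneg _).trans (hC 0)
      · exact hC i
  have h3 : |∑' i, (c m i - β i) * (if i < K then 0 else y i)| ≤
      ε / (4 * (M + 1)) * (2 * M) := by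
    refine (tsum_mul_le (hds m) (C := ε / (4 * (M + 1))) fun i => ?_).trans
      (mul_le_mul_of_nonneg_left (hdM m) hδ.le)
    split_ifs with h
    · simpa using hδ.le
    · have := hK i (not_lt.1 h)
      rw [Real.dist_eq, sub_zero] at this
      exact this.le
  have h4 : ε / (4 * (M + 1)) * (2 * M) ≤ ε / 2 := by
    rw [div_mul_eq_mul_div, div_le_div_iff₀ (by positivity) (by positivity)]
    nlinarith
  have h5 := hN m hm
  rw [Real.dist_eq, sub_zero] at h5
  rw [Real.dist_eq, h1, h2]
  calc _ ≤ _ := abs_add_le _ _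
    _ < ε := by linarith

/-- bounded sequences converging pointwise, tested against an `ℓ¹` sequence. -/
lemma dom_conv {b : ℕ → ℝ} (hb : Summable fun i => |b i|) {v : ℕ → ℕ → ℝ} {w : ℕ → ℝ} {C : ℝ}
    (hv : ∀ j i, |v j i| ≤ C) (hw : ∀ i, Tendsto (fun j => v j i) atTop (𝓝 (w i))) :
    Tendsto (fun j => ∑' i, b i * v j i) atTop (𝓝 (∑' i, b i * w i)) := by
  refine tendsto_tsum_of_dominated_convergence (bound := fun i => |b i| * C) (hb.mul_right C)
    (fun i => (hw i).const_mul _) (Eventually.of_forall fun j i => ?_)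
  rw [Real.norm_eq_abs, abs_mul]
  exact mul_le_mul_of_nonneg_left (hv j i) (abs_nonneg _)

lemma schur_cauchy (c : ℕ → ℕ → ℝ) (hs : ∀ m, Summable fun i => |c m i|)
    (hc : ∀ y : ℕ → ℝ, (∀ i, |y i| ≤ 1) →
      ∃ L, Tendsto (fun m => ∑' i, c m i * y i) atTop (𝓝 L))
    {β : ℕ → ℝ} (hβ : ∀ i, Tendsto (fun m => c m i) atTop (𝓝 (β i))) {ε : ℝ} (hε : 0 < ε) :
    ∃ N, ∀ m ≥ N, ∀ K, ∑ i ∈ Finset.range K, |c m i - β i| ≤ 3 * ε := by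
  let S := ℕ → Set.Icc (-1 : ℝ) 1
  let F : ℕ → Set S := fun N => {y | ∀ m ≥ N, ∀ p ≥ N,
    |∑' i, c m i * (y i : ℝ) - ∑' i, c p i * (y i : ℝ)| ≤ ε}
  have hb : ∀ (y : S) i, |(y i : ℝ)| ≤ 1 := fun y i => abs_le.2 (y i).2
  have hcont : ∀ m, Continuous fun y : S => ∑' i, c m i * (y i : ℝ) := fun m => by
    refine continuous_tsum (u := fun i => |c m i|) (fun i => by fun_prop) (hs m) fun i y => ?_
    rw [Real.norm_eq_abs, abs_mul]
    exact mul_le_of_le_one_right (abs_nonneg _) (hb y i)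
  have hclosed : ∀ N, IsClosed (F N) := fun N => by
    have : F N = ⋂ m, ⋂ (_ : m ≥ N), ⋂ p, ⋂ (_ : p ≥ N),
        {y : S | |∑' i, c m i * (y i : ℝ) - ∑' i, c p i * (y i : ℝ)| ≤ ε} := by
      ext y
      simp [F]
    rw [this]
    refine isClosed_iInter fun m => isClosed_iInter fun _ => isClosed_iInter fun p =>
      isClosed_iInter fun _ => isClosed_le ((hcont m).sub (hcont p)).abs continuous_const
  have hU : ⋃ N, F N = Set.univ := by
    refine Set.eq_univ_of_forall fun y => ?_
    obtain ⟨L, hL⟩ := hc (fun i => (y i : ℝ)) (hb y)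
    obtain ⟨N, hN⟩ := Metric.cauchySeq_iff.1 hL.cauchySeq ε hε
    refine Set.mem_iUnion.2 ⟨N, fun m hm p hp => ?_⟩
    have := hN m hm p hp
    rw [Real.dist_eq] at this
    exact this.le
  have : Nonempty S := ⟨fun _ => ⟨0, by norm_num, by norm_num⟩⟩
  obtain ⟨N, y0, hy0⟩ := nonempty_interior_of_iUnion_of_closed hclosed hU
  obtain ⟨J, u, hu, hJ⟩ := isOpen_pi_iff.1 isOpen_interior y0 hy0
  have hfin : ∀ᶠ m in atTop, ∑ i ∈ J, |c m i - β i| < ε / 2 := by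
    have : Tendsto (fun m => ∑ i ∈ J, |c m i - β i|) atTop (𝓝 (∑ i ∈ J, |β i - β i|)) :=
      tendsto_finsetSum _ fun i _ => ((hβ i).sub_const _).abs
    simp only [sub_self, abs_zero, Finset.sum_const_zero] at this
    exact this.eventually_lt_const (by positivity)
  obtain ⟨N1, hN1⟩ := eventually_atTop.1 hfin
  have key : ∀ m ≥ max N N1, ∀ p ≥ max N N1, ∑' i, |c m i - c p i| ≤ 3 * ε := by
    intro m hm p hp
    have hm1 := hN1 m (le_trans (le_max_right _ _) hm)
    have hp1 := hN1 p (le_trans (le_max_right _ _) hp)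
    have hJs : ∑ i ∈ J, |c m i - c p i| ≤ ε := by
      calc ∑ i ∈ J, |c m i - c p i| ≤ ∑ i ∈ J, (|c m i - β i| + |c p i - β i|) := by
            refine Finset.sum_le_sum fun i _ => ?_
            rw [abs_sub_comm (c p i)]
            exact abs_sub_le _ _ _
        _ ≤ ε := by rw [Finset.sum_add_distrib]; linarith
    let d : ℕ → ℝ := fun i => c m i - c p i
    have hds : Summable fun i => |d i| :=
      Summable.of_nonneg_of_le (fun i => abs_nonneg _) (fun i => abs_sub _ _) ((hs m).add (hs p))
    let y : S := fun i => if i ∈ J then y0 i else ⟨sg (d i), abs_le.1 (abs_sg _).le⟩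
    have hy : y ∈ F N := by
      refine interior_subset (hJ ?_)
      intro i hi
      have hi' : i ∈ J := hi
      have : y i = y0 i := if_pos hi'
      rw [this]
      exact (hu i hi').2
    have h1 := hy m (le_trans (le_max_left _ _) hm) p (le_trans (le_max_left _ _) hp)
    rw [← (summ_mul (hs m) (hb y)).of_abs.tsum_sub (summ_mul (hs p) (hb y)).of_abs] at h1
    have h2 : ∑' i, (c m i * (y i : ℝ) - c p i * (y i : ℝ)) =
        ∑' i, (|d i| + (if i ∈ J then d i * (y0 i : ℝ) - |d i| else 0)) := by
      refine tsum_congr fun i => ?_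
      by_cases hi : i ∈ J
      · have : y i = y0 i := if_pos hi
        rw [this, if_pos hi]
        simp only [d]; ring
      · have : (y i : ℝ) = sg (d i) := by
          have : y i = ⟨sg (d i), abs_le.1 (abs_sg _).le⟩ := if_neg hi
          rw [this]
        rw [this, if_neg hi, ← mul_sg (d i)]
        simp only [d]; ring
    have h3 : HasSum (fun i => if i ∈ J then d i * (y0 i : ℝ) - |d i| else 0)
        (∑ i ∈ J, (d i * (y0 i : ℝ) - |d i|)) := by
      have := hasSum_sum_of_ne_finset_zero (s := J) (L := SummationFilter.unconditional ℕ)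
        (f := fun i => if i ∈ J then d i * (y0 i : ℝ) - |d i| else 0)
        (fun i hi => if_neg hi)
      rwa [Finset.sum_congr rfl (fun i hi => if_pos hi)] at this
    rw [h2, hds.tsum_add h3.summable, h3.tsum_eq] at h1
    have h4 : -(2 * ε) ≤ ∑ i ∈ J, (d i * (y0 i : ℝ) - |d i|) := by
      have : ∑ i ∈ J, (-(2 * |d i|)) ≤ ∑ i ∈ J, (d i * (y0 i : ℝ) - |d i|) := by
        refine Finset.sum_le_sum fun i _ => ?_
        have h5 : |d i * (y0 i : ℝ)| ≤ |d i| := by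
          rw [abs_mul]
          exact mul_le_of_le_one_right (abs_nonneg _) (hb y0 i)
        have := (abs_le.1 h5).1
        linarith
      rw [Finset.sum_neg_distrib, ← Finset.mul_sum] at this
      have hJs' : ∑ i ∈ J, |d i| ≤ ε := hJs
      linarith
    have h5 := (abs_le.1 h1).2
    change ∑' i, |d i| ≤ 3 * ε
    linarith
  refine ⟨max N N1, fun m hm K => ?_⟩
  have hlim : Tendsto (fun p => ∑ i ∈ Finset.range K, |c m i - c p i|) atTop
      (𝓝 (∑ i ∈ Finset.range K, |c m i - β i|)) :=
    tendsto_finsetSum _ fun i _ => ((hβ i).const_sub _).abs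
  refine le_of_tendsto hlim ?_
  filter_upwards [eventually_ge_atTop (max N N1)] with p hp
  have hds : Summable fun i => |c m i - c p i| :=
      Summable.of_nonneg_of_le (fun i => abs_nonneg _) (fun i => abs_sub _ _) ((hs m).add (hs p))
  exact (hds.sum_le_tsum _ fun i _ => abs_nonneg _).trans (key m hm p hp)

lemma linf_conv (c : ℕ → ℕ → ℝ) (hs : ∀ m, Summable fun i => |c m i|)
    (hc : ∀ y : ℕ → ℝ, (∀ i, |y i| ≤ 1) →
      ∃ L, Tendsto (fun m => ∑' i, c m i * y i) atTop (𝓝 L))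
    {β : ℕ → ℝ} (hβ : ∀ i, Tendsto (fun m => c m i) atTop (𝓝 (β i)))
    (hbs : Summable fun i => |β i|) {y : ℕ → ℝ} {C : ℝ} (hC : ∀ i, |y i| ≤ C) :
    Tendsto (fun m => ∑' i, c m i * y i) atTop (𝓝 (∑' i, β i * y i)) := by
  have hC0 : 0 ≤ C := (abs_nonneg _).trans (hC 0)
  rw [Metric.tendsto_atTop]
  intro ε hε
  obtain ⟨N, hN⟩ := schur_cauchy c hs hc hβ (ε := ε / (4 * (C + 1))) (by positivity)
  refine ⟨N, fun m hm => ?_⟩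
  have hds : Summable fun i => |c m i - β i| :=
    Summable.of_nonneg_of_le (fun i => abs_nonneg _) (fun i => abs_sub _ _) ((hs m).add hbs)
  have h1 : ∑' i, c m i * y i - ∑' i, β i * y i = ∑' i, (c m i - β i) * y i := by
    rw [← (summ_mul (hs m) hC).of_abs.tsum_sub (summ_mul hbs hC).of_abs]
    exact tsum_congr fun i => by ring
  rw [Real.dist_eq, h1]
  have h2 := Real.tsum_le_of_sum_range_le (fun i => abs_nonneg _) (hN m hm)
  have h3 : C * (3 * (ε / (4 * (C + 1)))) < ε := by
    rw [← mul_div_assoc, ← mul_div_assoc, div_lt_iff₀ (by positivity)]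
    nlinarith
  exact ((tsum_mul_le hds hC).trans (mul_le_mul_of_nonneg_left h2 hC0)).trans_lt h3

/-- `Y` is `c₀` or `ℓ∞`. -/
def IsY (Y : Set (ℕ → ℝ)) : Prop :=
  Y = {y | Tendsto y atTop (𝓝 0)} ∨ Y = {y | ∃ C : ℝ, ∀ n, |y n| ≤ C}

lemma IsY.c0 {Y : Set (ℕ → ℝ)} (hY : IsY Y) {y : ℕ → ℝ} (h : Tendsto y atTop (𝓝 0)) : y ∈ Y := by
  rcases hY with rfl | rfl
  · exact h
  · exact bdd_of_tendsto h

lemma IsY.bdd {Y : Set (ℕ → ℝ)} (hY : IsY Y) {y : ℕ → ℝ} (h : y ∈ Y) : ∃ C : ℝ, ∀ n, |y n| ≤ C := by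
  rcases hY with rfl | rfl
  · exact bdd_of_tendsto h
  · exact h

lemma IsY.main {Y : Set (ℕ → ℝ)} (hY : IsY Y) (c : ℕ → ℕ → ℝ)
    (hs : ∀ m, Summable fun i => |c m i|)
    (hc : ∀ y ∈ Y, ∃ L, Tendsto (fun m => ∑' i, c m i * y i) atTop (𝓝 L))
    {β : ℕ → ℝ} (hβ : ∀ i, Tendsto (fun m => c m i) atTop (𝓝 (β i))) :
    (∃ M, ∀ m, ∑' i, |c m i| ≤ M) ∧ (Summable fun i => |β i|) ∧
      ∀ y ∈ Y, Tendsto (fun m => ∑' i, c m i * y i) atTop (𝓝 (∑' i, β i * y i)) := by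
  obtain ⟨M, hM⟩ := bs_bound c hs fun y hy => hc y (hY.c0 hy)
  have hb := (lim_summable hs hM hβ).1
  refine ⟨⟨M, hM⟩, hb, fun y hy => ?_⟩
  rcases hY with rfl | rfl
  · exact c0_conv hs hM hβ hy
  · obtain ⟨C, hC⟩ := hy
    exact linf_conv c hs (fun y hy => hc y ⟨1, hy⟩) hβ hb hC

lemma row_partial (α : ℝ) (a y : ℕ → ℝ) (m : ℕ) :
    ∑ k ∈ Finset.range m, a k * fracDeltaSeq (-α) y k =
      ∑ i ∈ Finset.range m,
        (∑ j ∈ Finset.range (m - i), fracDelta (-α) (i + j) i * a (i + j)) * y i := by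
  simp only [fracDeltaSeq, Finset.mul_sum, Finset.sum_mul]
  rw [Finset.sum_comm' (t' := Finset.range m) (s' := fun i => Finset.Ico i m)]
  · refine Finset.sum_congr rfl fun i _ => ?_
    rw [Finset.sum_Ico_eq_sum_range]
    exact Finset.sum_congr rfl fun j _ => by ring
  · intro k i
    simp only [Finset.mem_range, Finset.mem_Ico]
    omega

lemma row_lemma (α : ℝ) {Y : Set (ℕ → ℝ)} (hY : IsY Y) (a b : ℕ → ℝ)
    (h : ∀ y ∈ Y, ∃ L, SeriesHasSum (fun k => a k * fracDeltaSeq (-α) y k) L)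
    (hb : ∀ k, SeriesHasSum (fun j => fracDelta (-α) (k + j) k * a (k + j)) (b k)) :
    (Summable fun i => |b i|) ∧
      ∀ y ∈ Y, SeriesHasSum (fun k => a k * fracDeltaSeq (-α) y k) (∑' i, b i * y i) := by
  let c : ℕ → ℕ → ℝ := fun m i =>
    ∑ j ∈ Finset.range (m - i), fracDelta (-α) (i + j) i * a (i + j)
  have hc0 : ∀ m i, i ∉ Finset.range m → c m i = 0 := by
    intro m i hi
    have : m - i = 0 := by
      have : ¬ i < m := by simpa using hi
      omega
    simp [c, this]
  have hs : ∀ m, Summable fun i => |c m i| := fun m =>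
    summable_of_ne_finset_zero (s := Finset.range m) fun i hi => by rw [hc0 m i hi, abs_zero]
  have heq : ∀ y : ℕ → ℝ, (fun m => ∑ k ∈ Finset.range m, a k * fracDeltaSeq (-α) y k) =
      fun m => ∑' i, c m i * y i := by
    intro y
    funext m
    rw [row_partial, tsum_eq_sum (s := Finset.range m)]
    intro i hi
    rw [hc0 m i hi, zero_mul]
  have hβ : ∀ i, Tendsto (fun m => c m i) atTop (𝓝 (b i)) := fun i =>
    (hb i).comp (tendsto_sub_atTop_nat i)
  obtain ⟨-, h1, h2⟩ := hY.main c hs (fun y hy => by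
    obtain ⟨L, hL⟩ := h y hy
    refine ⟨L, ?_⟩
    rw [← heq]
    exact hL) hβ
  refine ⟨h1, fun y hy => ?_⟩
  rw [SeriesHasSum, heq]
  exact h2 y hy

lemma bdd_sub {y z : ℕ → ℝ} {L L' : ℝ} (hy : Tendsto y atTop (𝓝 L)) (hz : Tendsto z atTop (𝓝 L')) :
    BddAbove (Set.range fun n => |y n - z n|) := (hy.sub hz).abs.bddAbove_range

/-- Compactness for the reduced matrix, forward direction. -/
lemma forward {Y : Set (ℕ → ℝ)} (hY : IsY Y) (B : ℕ → ℕ → ℝ) (β : ℕ → ℝ)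
    (hβ : ∀ k, Tendsto (fun n => B n k) atTop (𝓝 (β k)))
    (hconv : ∀ y ∈ Y, ∃ L, Tendsto (fun n => ∑' k, B n k * y k) atTop (𝓝 L))
    (hcomp : ∀ v : ℕ → (ℕ → ℝ), (∀ i, v i ∈ Y) → (∀ i k, |v i k| ≤ 1) →
      ∃ φ : ℕ → ℕ, StrictMono φ ∧
        ∃ z : ℕ → ℝ, (∃ L : ℝ, Tendsto z atTop (𝓝 L)) ∧
          Tendsto (fun i => ⨆ n, |∑' k, B n k * v (φ i) k - z n|) atTop (𝓝 0)) :
    Tendsto (fun r => ⨆ n : {n : ℕ // r ≤ n}, ∑' k, |B (n : ℕ) k - β k|) atTop (𝓝 0) := by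
  have key : ∀ η > 0, ∃ r, ∀ n ≥ r, ∀ K, ∑ k ∈ Finset.range K, |B n k - β k| ≤ η := by
    by_contra! hcon
    obtain ⟨η, hη, hcon⟩ := hcon
    choose nn hnn K hK using hcon
    let s : ℕ → ℕ → ℝ := fun r k => sg (B (nn r) k - β k)
    let v : ℕ → ℕ → ℝ := fun r k => if k < K r then s r k else 0
    have hvt : ∀ n r, ∑' k, B n k * v r k = ∑ k ∈ Finset.range (K r), B n k * s r k :=
      fun n r => tsum_cut (B n) (s r) (K r)
    obtain ⟨φ, hφ, z, ⟨L, hL⟩, hz⟩ := hcomp v (fun i => hY.c0 (cut_tendsto _ _)) (fun i k => by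
      simp only [v]
      split_ifs
      · exact (abs_sg _).le
      · simp)
    obtain ⟨I, hI⟩ := eventually_atTop.1 (hz.eventually_lt_const (show (0 : ℝ) < η / 4 by positivity))
    obtain ⟨N, hN⟩ := Metric.tendsto_atTop.1 hL (η / 4) (by positivity)
    let i := max I N
    have hle : ∀ n ≥ N, |∑' k, B n k * v (φ i) k - L| ≤ η / 2 := by
      intro n hn
      obtain ⟨L', hL'⟩ := hconv (v (φ i)) (hY.c0 (cut_tendsto _ _))
      have h1 := le_ciSup (bdd_sub hL' hL) n
      have h2 := hI i (le_max_left _ _)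
      have h3 := hN n hn
      rw [Real.dist_eq] at h3
      have h4 := abs_sub_le (∑' k, B n k * v (φ i) k) (z n) L
      linarith
    have hlim : Tendsto (fun n => |∑' k, B n k * v (φ i) k - L|) atTop
        (𝓝 |∑ k ∈ Finset.range (K (φ i)), β k * s (φ i) k - L|) := by
      simp only [hvt]
      exact ((tendsto_finsetSum _ fun k _ => (hβ k).mul_const _).sub_const _).abs
    have hle2 := le_of_tendsto hlim (eventually_atTop.2 ⟨N, hle⟩)
    have hni : nn (φ i) ≥ N :=
      (le_max_right I N).trans ((hφ.id_le i).trans (hnn (φ i)))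
    have h1 := hle _ hni
    have h2 := hK (φ i)
    have h3 : ∑ k ∈ Finset.range (K (φ i)), |B (nn (φ i)) k - β k| =
        ∑ k ∈ Finset.range (K (φ i)), B (nn (φ i)) k * s (φ i) k
          - ∑ k ∈ Finset.range (K (φ i)), β k * s (φ i) k := by
      rw [← Finset.sum_sub_distrib]
      refine Finset.sum_congr rfl fun k _ => ?_
      rw [← mul_sg]
      simp only [s]; ring
    rw [hvt] at h1
    have h4 := (abs_le.1 h1).2
    have h5 := (abs_le.1 hle2).1
    linarith
  rw [Metric.tendsto_atTop]
  intro ε hε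
  obtain ⟨r, hr⟩ := key (ε / 2) (by positivity)
  refine ⟨r, fun q hq => ?_⟩
  have h0 : 0 ≤ ⨆ n : {n : ℕ // q ≤ n}, ∑' k, |B (n : ℕ) k - β k| :=
    Real.iSup_nonneg fun n => tsum_nonneg fun k => abs_nonneg _
  have h1 : ⨆ n : {n : ℕ // q ≤ n}, ∑' k, |B (n : ℕ) k - β k| ≤ ε / 2 :=
    Real.iSup_le (fun n => Real.tsum_le_of_sum_range_le (fun k => abs_nonneg _)
      (hr n (le_trans hq n.2))) (by positivity)
  rw [Real.dist_eq, sub_zero, abs_of_nonneg h0]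
  linarith

/-- Compactness for the reduced matrix, backward direction. -/
lemma backward (B : ℕ → ℕ → ℝ) (β : ℕ → ℝ)
    (hs : ∀ n, Summable fun k => |B n k|) (hbs : Summable fun k => |β k|)
    {M : ℝ} (hM : ∀ n, ∑' k, |B n k| ≤ M)
    (hlim : Tendsto (fun r => ⨆ n : {n : ℕ // r ≤ n}, ∑' k, |B (n : ℕ) k - β k|) atTop (𝓝 0))
    (v : ℕ → (ℕ → ℝ)) {C : ℝ} (hv : ∀ i k, |v i k| ≤ C) :
      ∃ φ : ℕ → ℕ, StrictMono φ ∧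
        ∃ z : ℕ → ℝ, (∃ L : ℝ, Tendsto z atTop (𝓝 L)) ∧
          Tendsto (fun i => ⨆ n, |∑' k, B n k * v (φ i) k - z n|) atTop (𝓝 0) := by
  have hC0 : 0 ≤ C := (abs_nonneg _).trans (hv 0 0)
  have hds : ∀ n, Summable fun k => |B n k - β k| := fun n =>
    Summable.of_nonneg_of_le (fun i => abs_nonneg _) (fun i => abs_sub _ _) ((hs n).add hbs)
  have hdM : ∀ n, ∑' k, |B n k - β k| ≤ M + ∑' k, |β k| := fun n => by
    calc ∑' i, |B n i - β i| ≤ ∑' i, (|B n i| + |β i|) :=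
          (hds n).tsum_le_tsum (fun i => abs_sub _ _) ((hs n).add hbs)
      _ = _ := (hs n).tsum_add hbs
      _ ≤ _ := by linarith [hM n]
  have hlim' : ∀ η > 0, ∃ r, ∀ n ≥ r, ∑' k, |B n k - β k| < η := by
    intro η hη
    obtain ⟨r, hr⟩ := (hlim.eventually_lt_const hη).exists
    refine ⟨r, fun n hn => lt_of_le_of_lt ?_ hr⟩
    exact le_ciSup (f := fun n : {n : ℕ // r ≤ n} => ∑' k, |B (n : ℕ) k - β k|)
      ⟨_, by rintro _ ⟨n, rfl⟩; exact hdM n⟩ ⟨n, hn⟩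
  have hK : IsCompact (Set.univ.pi fun _ : ℕ => Set.Icc (-C) C) :=
    isCompact_univ_pi fun _ => isCompact_Icc
  obtain ⟨w, hw, φ, hφ, hφw⟩ := hK.tendsto_subseq (x := v) fun i k _ => abs_le.1 (hv i k)
  have hwC : ∀ k, |w k| ≤ C := fun k => abs_le.2 (hw k trivial)
  have hpt : ∀ k, Tendsto (fun i => v (φ i) k) atTop (𝓝 (w k)) := tendsto_pi_nhds.1 hφw
  have hsplit : ∀ n (y : ℕ → ℝ) (D : ℝ), (∀ k, |y k| ≤ D) →
      |∑' k, B n k * y k - ∑' k, β k * y k| ≤ D * ∑' k, |B n k - β k| := by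
    intro n y D hy
    rw [← (summ_mul (hs n) hy).of_abs.tsum_sub (summ_mul hbs hy).of_abs]
    simp only [← sub_mul]
    exact tsum_mul_le (hds n) hy
  refine ⟨φ, hφ, fun n => ∑' k, B n k * w k, ⟨∑' k, β k * w k, ?_⟩, ?_⟩
  · rw [Metric.tendsto_atTop]
    intro ε hε
    obtain ⟨r, hr⟩ := hlim' (ε / (C + 1)) (by positivity)
    refine ⟨r, fun n hn => ?_⟩
    rw [Real.dist_eq]
    refine (hsplit n w C hwC).trans_lt ?_
    have h1 := hr n hn
    rw [lt_div_iff₀ (by positivity)] at h1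
    have h2 : 0 ≤ ∑' k, |B n k - β k| := tsum_nonneg fun k => abs_nonneg _
    nlinarith
  · let e : ℕ → ℕ → ℝ := fun i k => v (φ i) k - w k
    have he : ∀ i k, |e i k| ≤ 2 * C := fun i k => by
      have := abs_sub (v (φ i) k) (w k)
      have h1 := hv (φ i) k
      have h2 := hwC k
      simp only [e]; linarith
    have he0 : ∀ k, Tendsto (fun i => e i k) atTop (𝓝 0) := fun k => by
      simpa using (hpt k).sub_const (w k)
    have heB : ∀ n i, ∑' k, B n k * v (φ i) k - ∑' k, B n k * w k = ∑' k, B n k * e i k := by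
      intro n i
      rw [← (summ_mul (hs n) (hv _)).of_abs.tsum_sub (summ_mul (hs n) hwC).of_abs]
      simp only [← mul_sub, e]
    simp only [heB]
    have hb0 : ∀ b : ℕ → ℝ, (Summable fun k => |b k|) →
        Tendsto (fun i => ∑' k, b k * e i k) atTop (𝓝 0) := by
      intro b hb
      simpa using dom_conv hb he he0
    rw [Metric.tendsto_atTop]
    intro ε hε
    obtain ⟨r, hr⟩ := hlim' (ε / (8 * (C + 1))) (by positivity)
    have h1 : ∀ᶠ i in atTop, ∀ n ∈ Finset.range r, |∑' k, B n k * e i k| < ε / 2 := by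
      rw [Filter.eventually_all_finset]
      intro n _
      have := (hb0 (B n) (hs n)).abs
      rw [abs_zero] at this
      exact this.eventually_lt_const (by positivity)
    have h2 : ∀ᶠ i in atTop, |∑' k, β k * e i k| < ε / 4 := by
      have := (hb0 β hbs).abs
      rw [abs_zero] at this
      exact this.eventually_lt_const (by positivity)
    obtain ⟨I, hI⟩ := eventually_atTop.1 (h1.and h2)
    refine ⟨I, fun i hi => ?_⟩
    obtain ⟨h3, h4⟩ := hI i hi
    have h5 : ⨆ n, |∑' k, B n k * e i k| ≤ ε / 2 := by
      refine Real.iSup_le (fun n => ?_) (by positivity)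
      by_cases hn : n < r
      · exact (h3 n (Finset.mem_range.2 hn)).le
      · have h6 := hsplit n (e i) (2 * C) (he i)
        have h7 := hr n (not_lt.1 hn)
        have h8 : 2 * C * ∑' k, |B n k - β k| ≤ ε / 4 := by
          rw [lt_div_iff₀ (by positivity)] at h7
          have h2 : 0 ≤ ∑' k, |B n k - β k| := tsum_nonneg fun k => abs_nonneg _
          nlinarith
        have h9 := abs_sub_abs_le_abs_sub (∑' k, B n k * e i k) (∑' k, β k * e i k)
        linarith
    have h0 : 0 ≤ ⨆ n, |∑' k, B n k * e i k| := Real.iSup_nonneg fun n => abs_nonneg _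
    rw [Real.dist_eq, sub_zero, abs_of_nonneg h0]
    linarith

/-- Let `X ∈ {c₀(Δ^(α)), ℓ∞(Δ^(α))}` and `A ∈ (X, c)`. Then `L_A` is compact iff
`lim_r sup_{n≥r} ∑_k |â_{nk} − α̂_k| = 0`, where `α̂_k = lim_n â_{nk}` (which exists). -/
theorem compact_into_c (α : ℝ) (hα : ∀ m : ℤ, α ≠ (m : ℝ))
    (X : Set (ℕ → ℝ))
    (hX : X = {x | memC0Delta α x} ∨ X = {x | memLinfDelta α x})
    (a : ℕ → ℕ → ℝ)
    (hrows : ∀ x ∈ X, ∀ n : ℕ, ∃ L : ℝ, SeriesHasSum (fun k => a n k * x k) L)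
    (hmaps : ∀ x ∈ X, ∃ L : ℝ, Tendsto (matMul a x) atTop (nhds L))
    (Ahat : ℕ → ℕ → ℝ)
    (hAhat : ∀ n k, SeriesHasSum (fun j => fracDelta (-α) (k + j) k * a n (k + j)) (Ahat n k))
    (Alim : ℕ → ℝ)
    (hAlim : ∀ k, Tendsto (fun n => Ahat n k) atTop (nhds (Alim k))) :
    (∀ u : ℕ → (ℕ → ℝ), (∀ i, u i ∈ X) → (∃ C : ℝ, ∀ i, deltaNorm α (u i) ≤ C) →
      ∃ φ : ℕ → ℕ, StrictMono φ ∧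
        ∃ y : ℕ → ℝ, (∃ L : ℝ, Tendsto y atTop (nhds L)) ∧
          Tendsto (fun i => ⨆ n, |matMul a (u (φ i)) n - y n|) atTop (nhds 0)) ↔
    Tendsto (fun r => ⨆ n : {n : ℕ // r ≤ n}, ∑' k, |Ahat (n : ℕ) k - Alim k|) atTop
      (nhds 0) := by
  have hα' : ∀ m : ℤ, -α ≠ (m : ℝ) := by
    intro m h
    exact hα (-m) (by push_cast; linarith)
  have inv1 : ∀ y, fracDeltaSeq α (fracDeltaSeq (-α) y) = y := fds_inv α hα
  have inv2 : ∀ x, fracDeltaSeq (-α) (fracDeltaSeq α x) = x := by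
    intro x
    have := fds_inv (-α) hα' x
    rwa [neg_neg] at this
  let Y : Set (ℕ → ℝ) := {y | fracDeltaSeq (-α) y ∈ X}
  have hY : IsY Y := by
    rcases hX with rfl | rfl
    · left
      ext y
      simp [Y, memC0Delta, inv1]
    · right
      ext y
      simp [Y, memLinfDelta, inv1]
  have hXY : ∀ x ∈ X, fracDeltaSeq α x ∈ Y := by
    intro x hx
    change fracDeltaSeq (-α) (fracDeltaSeq α x) ∈ X
    rwa [inv2]
  have hrow : ∀ n, _ := fun n => row_lemma α hY (a n) (Ahat n)
    (fun y hy => hrows _ hy n) (hAhat n)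
  have hmat : ∀ y ∈ Y, matMul a (fracDeltaSeq (-α) y) = fun n => ∑' k, Ahat n k * y k := by
    intro y hy
    funext n
    exact ((hrow n).2 y hy).limUnder_eq
  have hmatX : ∀ x ∈ X, ∀ n, matMul a x n = ∑' k, Ahat n k * fracDeltaSeq α x k := by
    intro x hx n
    have := hmat _ (hXY x hx)
    rw [inv2] at this
    rw [this]
  have hconv : ∀ y ∈ Y, ∃ L, Tendsto (fun n => ∑' k, Ahat n k * y k) atTop (𝓝 L) := by
    intro y hy
    obtain ⟨L, hL⟩ := hmaps _ hy
    rw [hmat y hy] at hL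
    exact ⟨L, hL⟩
  obtain ⟨⟨M, hM⟩, hbs, -⟩ := hY.main Ahat (fun n => (hrow n).1) hconv hAlim
  constructor
  · intro hcomp
    refine forward hY Ahat Alim hAlim hconv fun v hv hv1 => ?_
    obtain ⟨φ, hφ, z, hz, hlim⟩ := hcomp (fun i => fracDeltaSeq (-α) (v i)) hv
      ⟨1, fun i => Real.iSup_le (fun n => by rw [inv1]; exact hv1 i n) zero_le_one⟩
    refine ⟨φ, hφ, z, hz, ?_⟩
    simp only [hmat _ (hv _)] at hlim
    exact hlim
  · intro hlim u hu ⟨C, hC⟩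
    obtain ⟨φ, hφ, z, hz, hlim⟩ := backward Ahat Alim (fun n => (hrow n).1) hbs hM hlim
      (fun i => fracDeltaSeq α (u i)) (C := C) (fun i k => by
        obtain ⟨D, hD⟩ := hY.bdd (hXY _ (hu i))
        refine le_trans ?_ (hC i)
        exact le_ciSup (f := fun n => |fracDeltaSeq α (u i) n|)
          ⟨D, by rintro _ ⟨n, rfl⟩; exact hD n⟩ k)
    refine ⟨φ, hφ, z, hz, ?_⟩
    simp only [hmatX _ (hu _)]
    exact hlim
end

section
/- Let α be a real number with α ∉ ℤ, let X be c₀(Δ^(α)) or ℓ∞(Δ^(α)), and suppose the infinite matrix A = (a_{nk}) maps X into ℓ₁. Then the bounded linear operator L_A : X → ℓ₁, L_A(x) = Ax, is a compact operator if and only if lim_{r→∞} ( sup over finite subsets N ⊂ ℕ all of whose elements are ≥ r of ∑_{k=0}^∞ |∑_{n∈N} â_{nk}| ) = 0, where â_{nk} = ∑_{j=k}^∞ (−1)^{j−k} Γ(−α+1)/((j−k)!·Γ(−α−j+k+1)) a_{nj}. -/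
open Filter Finset Topology

theorem baire_step (w : ℕ → ℕ → ℝ) (hfin : ∀ m i, m ≤ i → w m i = 0)
    (hconv : ∀ y : ℕ → ℝ, (∀ i, |y i| ≤ 1) →
      ∃ L, Tendsto (fun m => ∑ i ∈ range m, w m i * y i) atTop (𝓝 L))
    (ε : ℝ) (hε : 0 < ε) :
    ∃ J M : ℕ, ∀ m p K : ℕ, M ≤ m → M ≤ p → ∑ i ∈ Ico J K, |w m i - w p i| ≤ ε := by
  let Y := ℕ → Set.Icc (-1 : ℝ) 1
  let S : ℕ → Y → ℝ := fun m y => ∑ i ∈ range m, w m i * (y i : ℝ)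
  have hS : ∀ m, Continuous (S m) := fun m => by
    refine continuous_finsetSum _ fun i _ => ?_
    exact continuous_const.mul (continuous_subtype_val.comp (continuous_apply i))
  let F : ℕ → Set Y := fun M => {y | ∀ m p, M ≤ m → M ≤ p → |S m y - S p y| ≤ ε}
  have hF : ∀ M, IsClosed (F M) := fun M => by
    have : F M = ⋂ m, ⋂ p, ⋂ (_ : M ≤ m), ⋂ (_ : M ≤ p), {y | |S m y - S p y| ≤ ε} := by
      ext y; simp [F]
    rw [this]
    refine isClosed_iInter fun m => isClosed_iInter fun p => isClosed_iInter fun _ =>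
      isClosed_iInter fun _ => isClosed_le ((hS m).sub (hS p)).abs continuous_const
  have hU : ⋃ M, F M = Set.univ := by
    rw [Set.eq_univ_iff_forall]
    intro y
    obtain ⟨L, hL⟩ := hconv (fun i => (y i : ℝ)) (fun i => abs_le.2 (y i).2)
    obtain ⟨M, hM⟩ := Metric.cauchySeq_iff.1 hL.cauchySeq ε hε
    rw [Set.mem_iUnion]
    refine ⟨M, fun m p hm hp => ?_⟩
    have := hM m hm p hp
    rw [Real.dist_eq] at this
    exact this.le
  have : Nonempty Y := ⟨fun _ => ⟨0, by norm_num, by norm_num⟩⟩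
  obtain ⟨M, y0, hy0⟩ := nonempty_interior_of_iUnion_of_closed hF hU
  obtain ⟨I, u, hu, hsub⟩ := isOpen_pi_iff.1 isOpen_interior y0 hy0
  obtain ⟨J, hJ⟩ : ∃ J : ℕ, ∀ i ∈ I, i < J :=
    ⟨I.sup id + 1, fun i hi => Nat.lt_succ_of_le (Finset.le_sup (f := id) hi)⟩
  refine ⟨J, M, fun m p K hm hp => ?_⟩
  have key : ∀ y : Y, (∀ i, i < J → y i = y0 i) → |S m y - S p y| ≤ ε := by
    intro y hy
    have : y ∈ F M := interior_subset (hsub (by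
      intro i hi
      rw [hy i (hJ i hi)]
      exact (hu i hi).2))
    exact this m p hm hp
  let d : ℕ → ℝ := fun i => w m i - w p i
  let s : ℕ → Set.Icc (-1 : ℝ) 1 := fun i =>
    if 0 ≤ d i then ⟨1, by norm_num, by norm_num⟩ else ⟨-1, by norm_num, by norm_num⟩
  let s' : ℕ → Set.Icc (-1 : ℝ) 1 := fun i =>
    if 0 ≤ d i then ⟨-1, by norm_num, by norm_num⟩ else ⟨1, by norm_num, by norm_num⟩
  let y1 : Y := fun i => if i ∈ Ico J K then s i else y0 i
  let y2 : Y := fun i => if i ∈ Ico J K then s' i else y0 i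
  have h1 := key y1 (fun i hi => by
    have : i ∉ Ico J K := by simp; omega
    simp only [y1, this, if_false])
  have h2 := key y2 (fun i hi => by
    have : i ∉ Ico J K := by simp; omega
    simp only [y2, this, if_false])
  let B := m + p + K
  have hSB : ∀ q, q ≤ B → ∀ y : Y, S q y = ∑ i ∈ range B, w q i * (y i : ℝ) := by
    intro q hq y
    refine Finset.sum_subset (by simpa using hq) ?_
    intro i _ hi
    rw [hfin q i (by simpa using hi), zero_mul]
  have hdiff : (S m y1 - S p y1) - (S m y2 - S p y2) = 2 * ∑ i ∈ Ico J K, |d i| := by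
    rw [hSB m (by omega), hSB p (by omega), hSB m (by omega), hSB p (by omega)]
    rw [← Finset.sum_sub_distrib, ← Finset.sum_sub_distrib, ← Finset.sum_sub_distrib,
      Finset.mul_sum]
    symm
    refine Finset.sum_subset_zero_on_sdiff ?_ ?_ ?_
    · intro i hi; simp at hi ⊢; omega
    · intro i hi
      have : i ∉ Ico J K := (Finset.mem_sdiff.1 hi).2
      simp only [y1, y2, this, if_false]; ring
    · intro i hi
      simp only [y1, y2, hi, if_true, s, s']
      split_ifs with h
      · rw [abs_of_nonneg h]; simp only [d]; ring
      · rw [abs_of_neg (not_le.1 h)]; simp only [d]; ring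
  have h1' := abs_le.1 h1
  have h2' := abs_le.1 h2
  change ∑ i ∈ Ico J K, |d i| ≤ ε
  linarith [h1'.2, h2'.1]

theorem schur_step (w : ℕ → ℕ → ℝ) (hfin : ∀ m i, m ≤ i → w m i = 0)
    (hconv : ∀ y : ℕ → ℝ, (∀ i, |y i| ≤ 1) →
      ∃ L, Tendsto (fun m => ∑ i ∈ range m, w m i * y i) atTop (𝓝 L))
    (v : ℕ → ℝ) (hv : ∀ i, Tendsto (fun m => w m i) atTop (𝓝 (v i))) :
    Summable (fun i => |v i|) ∧
      Tendsto (fun m => ∑ i ∈ range m, w m i) atTop (𝓝 (∑' i, v i)) := by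
  have hB : ∀ ε > 0, ∃ J M : ℕ, ∀ m K : ℕ, M ≤ m → ∑ i ∈ Ico J K, |w m i - v i| ≤ ε := by
    intro ε hε
    obtain ⟨J, M, h⟩ := baire_step w hfin hconv ε hε
    refine ⟨J, M, fun m K hm => ?_⟩
    have ht : Tendsto (fun p => ∑ i ∈ Ico J K, |w m i - w p i|) atTop
        (𝓝 (∑ i ∈ Ico J K, |w m i - v i|)) :=
      tendsto_finsetSum _ fun i _ => (tendsto_const_nhds.sub (hv i)).abs
    exact le_of_tendsto ht (eventually_atTop.2 ⟨M, fun p hp => h m p K hm hp⟩)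
  have hsum : Summable (fun i => |v i|) := by
    obtain ⟨J, M, h⟩ := hB 1 one_pos
    refine summable_of_sum_range_le (c := ∑ i ∈ range J, |v i| + (1 + ∑ i ∈ range M, |w M i|))
      (fun _ => abs_nonneg _) fun K => ?_
    have h1 : ∑ i ∈ range K, |v i| ≤ ∑ i ∈ range J, |v i| + ∑ i ∈ Ico J K, |v i| := by
      rw [← Finset.sum_union (by
        rw [Finset.disjoint_left]; intro i hi hi'; simp at hi hi'; omega)]
      refine Finset.sum_le_sum_of_subset_of_nonneg ?_ (fun _ _ _ => abs_nonneg _)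
      intro i hi; simp at hi ⊢; omega
    have h2 : ∑ i ∈ Ico J K, |v i| ≤ ∑ i ∈ Ico J K, |w M i - v i| + ∑ i ∈ Ico J K, |w M i| := by
      rw [← Finset.sum_add_distrib]
      refine Finset.sum_le_sum fun i _ => ?_
      have := abs_sub (w M i) (w M i - v i)
      rw [sub_sub_cancel] at this
      linarith
    have h3 : ∑ i ∈ Ico J K, |w M i| ≤ ∑ i ∈ range M, |w M i| := by
      have : ∑ i ∈ Ico J K, |w M i| ≤ ∑ i ∈ range (K + M), |w M i| := by
        refine Finset.sum_le_sum_of_subset_of_nonneg ?_ (fun _ _ _ => abs_nonneg _)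
        intro i hi; simp at hi ⊢; omega
      refine this.trans (le_of_eq ?_)
      symm
      refine Finset.sum_subset (by simp) ?_
      intro i _ hi
      rw [hfin M i (by simpa using hi), abs_zero]
    have := h M K le_rfl
    linarith
  refine ⟨hsum, ?_⟩
  rw [Metric.tendsto_atTop]
  intro ε hε
  obtain ⟨J, M, h⟩ := hB (ε / 3) (by linarith)
  have ht : Tendsto (fun m => ∑ i ∈ range J, |w m i - v i|) atTop (𝓝 0) := by
    have : Tendsto (fun m => ∑ i ∈ range J, |w m i - v i|) atTop
        (𝓝 (∑ i ∈ range J, |v i - v i|)) :=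
      tendsto_finsetSum _ fun i _ => ((hv i).sub tendsto_const_nhds).abs
    simpa using this
  obtain ⟨M', hM'⟩ := eventually_atTop.1 (ht.eventually (gt_mem_nhds (show 0 < ε / 3 by linarith)))
  refine ⟨max M M', fun m hm => ?_⟩
  rw [Real.dist_eq]
  have hK : Tendsto (fun K => |∑ i ∈ range m, w m i - ∑ i ∈ range K, v i|) atTop
      (𝓝 |∑ i ∈ range m, w m i - ∑' i, v i|) :=
    (tendsto_const_nhds.sub hsum.of_abs.hasSum.tendsto_sum_nat).abs
  have : |∑ i ∈ range m, w m i - ∑' i, v i| ≤ ε / 3 + ε / 3 := by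
    refine le_of_tendsto hK (eventually_atTop.2 ⟨m + J, fun K hK => ?_⟩)
    have e1 : ∑ i ∈ range m, w m i = ∑ i ∈ range K, w m i := by
      refine Finset.sum_subset (by simp; omega) ?_
      intro i _ hi
      exact hfin m i (by simpa using hi)
    rw [e1, ← Finset.sum_sub_distrib]
    refine (Finset.abs_sum_le_sum_abs _ _).trans ?_
    rw [← Finset.sum_range_add_sum_Ico _ (show J ≤ K by omega)]
    exact add_le_add (hM' m (le_trans (le_max_right _ _) hm)).le
      (h m K (le_trans (le_max_left _ _) hm))
  linarith


theorem bs_step {ι : Type*} (b : ι → ℕ → ℝ) (hb : ∀ i, Summable (fun k => |b i k|))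
    (h : ∀ z : ℕ → ℝ, Tendsto z atTop (𝓝 0) → ∃ C, ∀ i, |∑' k, b i k * z k| ≤ C) :
    ∃ M, ∀ i, ∑' k, |b i k| ≤ M := by
  have hle : ∀ (z : ZeroAtInftyContinuousMap ℕ ℝ) (k : ℕ), |z k| ≤ ‖z‖ := by
    intro z k
    exact z.toBCF.norm_coe_le_norm k
  have hs' : ∀ i (z : ZeroAtInftyContinuousMap ℕ ℝ), Summable (fun k => |b i k * z k|) := by
    intro i z
    refine Summable.of_nonneg_of_le (fun _ => abs_nonneg _) (fun k => ?_) ((hb i).mul_right ‖z‖)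
    rw [abs_mul]
    exact mul_le_mul_of_nonneg_left (hle z k) (abs_nonneg _)
  have hs : ∀ i (z : ZeroAtInftyContinuousMap ℕ ℝ), Summable (fun k => b i k * z k) :=
    fun i z => (hs' i z).of_abs
  let T : ι → (ZeroAtInftyContinuousMap ℕ ℝ →L[ℝ] ℝ) := fun i =>
    LinearMap.mkContinuous
      { toFun := fun z => ∑' k, b i k * z k
        map_add' := fun z z' => by
          rw [← (hs i z).tsum_add (hs i z')]
          exact tsum_congr fun k => show b i k * (z k + z' k) = b i k * z k + b i k * z' k from mul_add _ _ _
        map_smul' := fun c z => by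
          simp only [smul_eq_mul, RingHom.id_apply]
          rw [← tsum_mul_left]
          exact tsum_congr fun k => show b i k * (c * z k) = c * (b i k * z k) by ring } (∑' k, |b i k|) (fun z => by
        change ‖∑' k, b i k * z k‖ ≤ _
        rw [← tsum_mul_right]
        refine (norm_tsum_le_tsum_norm (f := fun k => b i k * z k) (hs' i z)).trans ?_
        refine Summable.tsum_le_tsum (fun k => ?_) (hs' i z) ((hb i).mul_right _)
        rw [Real.norm_eq_abs, abs_mul]
        exact mul_le_mul_of_nonneg_left (hle z k) (abs_nonneg _))
  have hT : ∀ i z, T i z = ∑' k, b i k * z k := fun i z => rfl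
  obtain ⟨M, hM⟩ := banach_steinhaus (g := T) (fun z => by
    obtain ⟨C, hC⟩ := h z (by
      have := z.zero_at_infty'
      rw [Filter.cocompact_eq_cofinite, Nat.cofinite_eq_atTop] at this
      exact this)
    exact ⟨C, fun i => by rw [hT, Real.norm_eq_abs]; exact hC i⟩)
  refine ⟨M, fun i => ?_⟩
  refine Real.tsum_le_of_sum_range_le (fun _ => abs_nonneg _) fun m => ?_
  let s : ℕ → ℝ := fun k => if k < m then (if 0 ≤ b i k then 1 else -1) else 0
  let z : ZeroAtInftyContinuousMap ℕ ℝ :=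
    { toFun := s
      continuous_toFun := continuous_of_discreteTopology
      zero_at_infty' := by
        rw [Filter.cocompact_eq_cofinite, Nat.cofinite_eq_atTop]
        refine tendsto_const_nhds.congr' (eventually_atTop.2 ⟨m, fun k hk => ?_⟩)
        simp [s, not_lt.2 hk] }
  have hz : ∀ k, z k = s k := fun k => rfl
  have hzn : ‖z‖ ≤ 1 := by
    change ‖z.toBCF‖ ≤ 1
    rw [BoundedContinuousFunction.norm_le zero_le_one]
    intro k
    change ‖s k‖ ≤ 1
    simp only [s]; split_ifs <;> simp
  have h1 : T i z = ∑ k ∈ range m, |b i k| := by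
    rw [hT, tsum_eq_sum (s := range m)]
    · refine Finset.sum_congr rfl fun k hk => ?_
      rw [hz]
      simp only [s, Finset.mem_range.1 hk, if_true]
      split_ifs with h
      · rw [abs_of_nonneg h, mul_one]
      · rw [abs_of_neg (not_le.1 h)]; ring
    · intro k hk
      rw [hz]; simp only [s, Finset.mem_range.not.1 hk, if_false, mul_zero]
  rw [← h1]
  refine (le_abs_self _).trans ?_
  have h2 := (T i).le_opNorm z
  rw [Real.norm_eq_abs] at h2
  have h3 : ‖T i‖ * ‖z‖ ≤ ‖T i‖ * 1 := mul_le_mul_of_nonneg_left hzn (T i).opNorm_nonneg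
  linarith [hM i]

noncomputable def dser (α : ℝ) : PowerSeries ℝ :=
  PowerSeries.rescale (-1 : ℝ) (PowerSeries.binomialSeries ℝ α)

theorem dser_coeff (α : ℝ) (n : ℕ) :
    PowerSeries.coeff n (dser α) = (-1) ^ n * Ring.choose α n := by
  simp [dser, PowerSeries.coeff_rescale, PowerSeries.binomialSeries_coeff]

theorem dser_mul (α β : ℝ) (h : α + β = 0) : dser α * dser β = 1 := by
  rw [dser, dser, ← map_mul, ← PowerSeries.binomialSeries_add, h,
    PowerSeries.binomialSeries_zero, map_one]

theorem gamma_choose (α : ℝ) (hα : ∀ m : ℤ, α ≠ (m : ℝ)) (j : ℕ) :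
    Real.Gamma (α + 1) = (j.factorial : ℝ) * Ring.choose α j * Real.Gamma (α - j + 1) := by
  have h0 : ∀ j : ℕ, (j.factorial : ℝ) * Ring.choose α j =
      (descPochhammer ℤ j).smeval α := by
    intro j
    rw [Ring.descPochhammer_eq_factorial_smul_choose, nsmul_eq_mul]
  rw [h0]
  induction j with
  | zero => simp
  | succ j ih =>
    rw [ih, descPochhammer_succ_right, Polynomial.smeval_mul]
    have h1 : α - j ≠ 0 := by
      intro h
      exact hα j (by push_cast; linarith)
    have h2 : α - ((j + 1 : ℕ) : ℝ) + 1 = α - j := by push_cast; ring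
    rw [h2, Real.Gamma_add_one h1]
    simp [Polynomial.smeval_natCast]
    ring

theorem fracDelta_eq (α : ℝ) (hα : ∀ m : ℤ, α ≠ (m : ℝ)) (n k : ℕ) (h : k ≤ n) :
    fracDelta α n k = PowerSeries.coeff (n - k) (dser α) := by
  rw [dser_coeff, fracDelta, if_pos h, gamma_choose α hα (n - k)]
  have e : α - ((n - k : ℕ) : ℝ) + 1 = α - n + k + 1 := by
    rw [Nat.cast_sub h]; ring
  rw [e]
  have h1 : Real.Gamma (α - n + k + 1) ≠ 0 := by
    apply Real.Gamma_ne_zero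
    intro m hm
    exact hα (n - k - 1 - m) (by push_cast; linarith)
  have h2 : ((n - k).factorial : ℝ) ≠ 0 := by positivity
  field_simp

theorem fracDeltaSeq_eq (α : ℝ) (hα : ∀ m : ℤ, α ≠ (m : ℝ)) (x : ℕ → ℝ) (n : ℕ) :
    fracDeltaSeq α x n = PowerSeries.coeff n (dser α * PowerSeries.mk x) := by
  rw [mul_comm, PowerSeries.coeff_mul, Finset.Nat.sum_antidiagonal_eq_sum_range_succ_mk, fracDeltaSeq]
  refine Finset.sum_congr rfl fun k hk => ?_
  rw [fracDelta_eq α hα n k (by simp at hk; omega), PowerSeries.coeff_mk, mul_comm]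

theorem neg_nonint (α : ℝ) (hα : ∀ m : ℤ, α ≠ (m : ℝ)) : ∀ m : ℤ, -α ≠ (m : ℝ) := by
  intro m h
  exact hα (-m) (by push_cast; linarith)

theorem fracDeltaSeq_inv (α β : ℝ) (hα : ∀ m : ℤ, α ≠ (m : ℝ)) (hβ : ∀ m : ℤ, β ≠ (m : ℝ))
    (h : α + β = 0) (x : ℕ → ℝ) : fracDeltaSeq α (fracDeltaSeq β x) = x := by
  funext n
  rw [fracDeltaSeq_eq α hα]
  have : PowerSeries.mk (fracDeltaSeq β x) = dser β * PowerSeries.mk x := by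
    ext k
    rw [PowerSeries.coeff_mk, fracDeltaSeq_eq β hβ]
  rw [this, ← mul_assoc, dser_mul α β h, one_mul, PowerSeries.coeff_mk]

theorem partial_swap (a : ℕ → ℝ) (β : ℝ) (z : ℕ → ℝ) (m : ℕ) :
    ∑ k ∈ range m, a k * fracDeltaSeq β z k =
      ∑ i ∈ range m, (∑ k ∈ range m, fracDelta β k i * a k) * z i := by
  simp_rw [Finset.sum_mul]
  rw [Finset.sum_comm]
  refine Finset.sum_congr rfl fun k hk => ?_
  rw [fracDeltaSeq, Finset.mul_sum]
  have hk' := Finset.mem_range.1 hk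
  rw [← Finset.sum_subset (s₁ := range (k + 1)) (s₂ := range m)]
  · exact Finset.sum_congr rfl fun i _ => by ring
  · intro i hi; simp at hi ⊢; omega
  · intro i _ hi
    have : ¬ i ≤ k := by simp at hi; omega
    simp [fracDelta, this]

theorem what_tendsto (a : ℕ → ℝ) (β : ℝ) (i : ℕ) (l : ℝ)
    (h : SeriesHasSum (fun j => fracDelta β (i + j) i * a (i + j)) l) :
    Tendsto (fun m => ∑ k ∈ range m, fracDelta β k i * a k) atTop (𝓝 l) := by
  rw [← tendsto_add_atTop_iff_nat i]
  refine Tendsto.congr (fun m => ?_) h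
  rw [add_comm m i, Finset.sum_range_add]
  rw [Finset.sum_eq_zero (s := range i), zero_add]
  intro k hk
  have : ¬ i ≤ k := by simp at hk; omega
  simp [fracDelta, this]

/-- Row representation. -/
theorem row_rep (a : ℕ → ℝ) (β : ℝ) (Ah : ℕ → ℝ)
    (hA : ∀ k, SeriesHasSum (fun j => fracDelta β (k + j) k * a (k + j)) (Ah k))
    (z : ℕ → ℝ)
    (hz : ∀ y : ℕ → ℝ, (∀ i, |y i| ≤ 1) → ∃ L,
      SeriesHasSum (fun k => a k * fracDeltaSeq β (fun i => z i * y i) k) L) :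
    Summable (fun i => |Ah i * z i|) ∧
      Tendsto (fun m => ∑ k ∈ range m, a k * fracDeltaSeq β z k) atTop
        (𝓝 (∑' i, Ah i * z i)) := by
  have := schur_step (fun m i => (∑ k ∈ range m, fracDelta β k i * a k) * z i)
    (fun m i hmi => by
      rw [Finset.sum_eq_zero, zero_mul]
      intro k hk
      have : ¬ i ≤ k := by simp at hk; omega
      simp [fracDelta, this])
    (fun y hy => by
      obtain ⟨L, hL⟩ := hz y hy
      refine ⟨L, Tendsto.congr (fun m => ?_) hL⟩
      rw [partial_swap]
      exact Finset.sum_congr rfl fun i _ => by ring)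
    (fun i => Ah i * z i) (fun i => (what_tendsto a β i _ (hA i)).mul_const _)
  refine ⟨this.1, this.2.congr fun m => ?_⟩
  rw [partial_swap]

theorem sign_test (b : ℕ → ℝ) (m : ℕ) : ∃ z : ℕ → ℝ, (∀ k, |z k| ≤ 1) ∧
    Tendsto z atTop (𝓝 0) ∧ ∑' k, b k * z k = ∑ k ∈ range m, |b k| := by
  refine ⟨fun k => if k < m then (if 0 ≤ b k then 1 else -1) else 0, ?_, ?_, ?_⟩
  · intro k; dsimp only; split_ifs <;> simp
  · refine tendsto_const_nhds.congr' (eventually_atTop.2 ⟨m, fun k hk => ?_⟩)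
    simp [not_lt.2 hk]
  · rw [tsum_eq_sum (s := range m)]
    · refine Finset.sum_congr rfl fun k hk => ?_
      simp only [Finset.mem_range.1 hk, if_true]
      split_ifs with h
      · rw [abs_of_nonneg h, mul_one]
      · rw [abs_of_neg (not_le.1 h)]; ring
    · intro k hk
      simp only [Finset.mem_range.not.1 hk, if_false, mul_zero]

theorem sum_abs_le_two (g : ℕ → ℝ) (s : Finset ℕ) (c : ℝ)
    (h : ∀ t ⊆ s, |∑ n ∈ t, g n| ≤ c) : ∑ n ∈ s, |g n| ≤ 2 * c := by
  classical
  rw [← Finset.sum_filter_add_sum_filter_not s (fun n => 0 ≤ g n)]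
  have h1 := h _ (Finset.filter_subset (fun n => 0 ≤ g n) s)
  have h2 := h _ (Finset.filter_subset (fun n => ¬ 0 ≤ g n) s)
  have e1 : ∑ n ∈ s with 0 ≤ g n, |g n| = ∑ n ∈ s with 0 ≤ g n, g n :=
    Finset.sum_congr rfl fun n hn => abs_of_nonneg (Finset.mem_filter.1 hn).2
  have e2 : ∑ n ∈ s with ¬ 0 ≤ g n, |g n| = - ∑ n ∈ s with ¬ 0 ≤ g n, g n := by
    rw [← Finset.sum_neg_distrib]
    exact Finset.sum_congr rfl fun n hn => abs_of_neg (not_le.1 (Finset.mem_filter.1 hn).2)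
  rw [e1, e2]
  linarith [(abs_le.1 h1).2, (abs_le.1 h2).1]

theorem core_bound (B : ℕ → ℕ → ℝ)
    (hBs : ∀ z : ℕ → ℝ, Tendsto z atTop (𝓝 0) → ∀ n, Summable (fun k => |B n k * z k|))
    (hmap : ∀ z : ℕ → ℝ, Tendsto z atTop (𝓝 0) → Summable (fun n => |∑' k, B n k * z k|)) :
    (∀ n, Summable (fun k => |B n k|)) ∧
      ∃ M, ∀ N : Finset ℕ, ∑' k, |∑ n ∈ N, B n k| ≤ M := by
  have hrow : ∀ n, Summable (fun k => |B n k|) := by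
    intro n
    have hsupp : ∀ (f : ℕ → ℝ) (m : ℕ), ∑' k, (if k < m then f k else 0) = ∑ k ∈ range m, f k := by
      intro f m
      rw [tsum_eq_sum (s := range m)]
      · exact Finset.sum_congr rfl fun k hk => by simp [Finset.mem_range.1 hk]
      · intro k hk; simp only [Finset.mem_range.not.1 hk, if_false]
    obtain ⟨M, hM⟩ := bs_step (fun (m : ℕ) k => if k < m then B n k else 0)
      (fun m => summable_of_ne_finset_zero (s := range m) (fun k hk => by
        simp only [Finset.mem_range.not.1 hk, if_false, abs_zero]))
      (fun z hz => ⟨∑' k, |B n k * z k|, fun m => by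
        have : (fun k => (if k < m then B n k else 0) * z k) =
            fun k => if k < m then B n k * z k else 0 := by
          funext k; split_ifs <;> simp
        rw [this, hsupp (fun k => B n k * z k)]
        exact (Finset.abs_sum_le_sum_abs _ _).trans
          ((hBs z hz n).sum_le_tsum _ (fun _ _ => abs_nonneg _))⟩)
    refine summable_of_sum_range_le (c := M) (fun _ => abs_nonneg _) fun m => ?_
    refine le_trans (le_of_eq ?_) (hM m)
    rw [← hsupp]
    refine tsum_congr fun k => ?_
    split_ifs <;> simp
  refine ⟨hrow, ?_⟩
  refine bs_step (fun (N : Finset ℕ) k => ∑ n ∈ N, B n k) (fun N => ?_) (fun z hz => ?_)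
  · refine Summable.of_nonneg_of_le (fun _ => abs_nonneg _)
      (fun k => Finset.abs_sum_le_sum_abs _ _) (summable_sum fun n _ => hrow n)
  · refine ⟨∑' n, |∑' k, B n k * z k|, fun N => ?_⟩
    simp_rw [Finset.sum_mul]
    rw [Summable.tsum_finsetSum (fun n _ => (hBs z hz n).of_abs)]
    exact (Finset.abs_sum_le_sum_abs _ _).trans
      ((hmap z hz).sum_le_tsum _ (fun _ _ => abs_nonneg _))

theorem core (P : (ℕ → ℝ) → Prop) (hP0 : ∀ z, Tendsto z atTop (𝓝 0) → P z)
    (B : ℕ → ℕ → ℝ)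
    (hBs : ∀ z, P z → ∀ n, Summable (fun k => |B n k * z k|))
    (hmap : ∀ z, P z → Summable (fun n => |∑' k, B n k * z k|)) :
    (∀ u : ℕ → ℕ → ℝ, (∀ i, P (u i)) → (∃ C : ℝ, ∀ i n, |u i n| ≤ C) →
      ∃ φ : ℕ → ℕ, StrictMono φ ∧ ∃ y : ℕ → ℝ, Summable (fun n => |y n|) ∧
        Tendsto (fun i => ∑' n, |∑' k, B n k * u (φ i) k - y n|) atTop (𝓝 0)) ↔
    Tendsto (fun r => sSup {t : ℝ | ∃ N : Finset ℕ, (∀ n ∈ N, r ≤ n) ∧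
        t = ∑' k, |∑ n ∈ N, B n k|}) atTop (𝓝 0) := by
  classical
  obtain ⟨hrow, M, hM⟩ := core_bound B (fun z hz => hBs z (hP0 z hz))
    (fun z hz => hmap z (hP0 z hz))
  have hbN : ∀ N : Finset ℕ, Summable (fun k => |∑ n ∈ N, B n k|) := fun N =>
    Summable.of_nonneg_of_le (fun _ => abs_nonneg _)
      (fun k => Finset.abs_sum_le_sum_abs _ _) (summable_sum fun n _ => hrow n)
  have hgN : ∀ z, P z → ∀ N : Finset ℕ,
      ∑ n ∈ N, ∑' k, B n k * z k = ∑' k, (∑ n ∈ N, B n k) * z k := by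
    intro z hz N
    simp_rw [Finset.sum_mul]
    rw [Summable.tsum_finsetSum (fun n _ => (hBs z hz n).of_abs)]
  set Q : ℕ → ℝ := fun r => sSup {t : ℝ | ∃ N : Finset ℕ, (∀ n ∈ N, r ≤ n) ∧
        t = ∑' k, |∑ n ∈ N, B n k|} with hQ
  have hQle : ∀ r (N : Finset ℕ), (∀ n ∈ N, r ≤ n) → ∑' k, |∑ n ∈ N, B n k| ≤ Q r := by
    intro r N hN
    refine le_csSup ⟨M, ?_⟩ ⟨N, hN, rfl⟩
    rintro t ⟨N, -, rfl⟩
    exact hM N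
  have hQ0 : ∀ r, 0 ≤ Q r := fun r =>
    le_trans (tsum_nonneg fun _ => abs_nonneg _) (hQle r ∅ (by simp))
  constructor
  · intro hcomp
    have claim : ∀ ε > 0, ∃ r : ℕ, ∀ z, P z → (∀ k, |z k| ≤ 1) → ∀ N : Finset ℕ,
        (∀ n ∈ N, r ≤ n) → |∑ n ∈ N, ∑' k, B n k * z k| ≤ ε := by
      intro ε hε
      by_contra! hcon
      choose z hz hz1 N hN hlt using hcon
      obtain ⟨φ, hφ, y, hy, hlim⟩ := hcomp z hz ⟨1, hz1⟩
      obtain ⟨s, hs⟩ := summable_iff_vanishing_norm.1 hy (ε / 2) (by linarith)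
      obtain ⟨r0, hr0⟩ : ∃ J : ℕ, ∀ i ∈ s, i < J :=
        ⟨s.sup id + 1, fun i hi => Nat.lt_succ_of_le (Finset.le_sup (f := id) hi)⟩
      obtain ⟨i, hi1, hi2⟩ := ((hlim.eventually (gt_mem_nhds (show 0 < ε / 2 by linarith))).and
        (eventually_ge_atTop r0)).exists
      have hNs : Disjoint (N (φ i)) s := by
        rw [Finset.disjoint_left]
        intro n hn hn'
        have h1 := hN (φ i) n hn
        have h2 := hr0 n hn'
        have h3 := hφ.id_le i
        simp only [id] at h3
        omega
      have h1 := hs _ hNs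
      have h2 := hlt (φ i)
      have hsd : Summable (fun n => |∑' k, B n k * z (φ i) k - y n|) :=
        ((hmap _ (hz (φ i))).of_abs.sub hy.of_abs).abs
      have h3 := hsd.sum_le_tsum (N (φ i)) (fun _ _ => abs_nonneg _)
      have h4 : |∑ n ∈ N (φ i), ∑' k, B n k * z (φ i) k| ≤
          ∑ n ∈ N (φ i), |∑' k, B n k * z (φ i) k - y n| + ∑ n ∈ N (φ i), |y n| := by
        refine (Finset.abs_sum_le_sum_abs _ _).trans ?_
        rw [← Finset.sum_add_distrib]
        refine Finset.sum_le_sum fun n _ => ?_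
        have := abs_add_le (∑' k, B n k * z (φ i) k - y n) (y n)
        rwa [sub_add_cancel] at this
      have h5 := (le_abs_self _).trans_lt (Real.norm_eq_abs _ ▸ h1)
      linarith
    rw [Metric.tendsto_atTop]
    intro ε hε
    obtain ⟨r, hr⟩ := claim (ε / 2) (by linarith)
    refine ⟨r, fun q hq => ?_⟩
    rw [Real.dist_eq, sub_zero, abs_of_nonneg (hQ0 q)]
    refine lt_of_le_of_lt (b := ε / 2) ?_ (by linarith)
    refine csSup_le ⟨_, ∅, by simp, rfl⟩ ?_
    rintro t ⟨N, hN, rfl⟩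
    refine Real.tsum_le_of_sum_range_le (fun _ => abs_nonneg _) fun m => ?_
    obtain ⟨z, hz1, hz0, hz⟩ := sign_test (fun k => ∑ n ∈ N, B n k) m
    rw [← hz, ← hgN z (hP0 z hz0)]
    exact (le_abs_self _).trans (hr z (hP0 z hz0) hz1 N fun n hn => hq.trans (hN n hn))
  · intro hlim u hu hC
    obtain ⟨C, hC⟩ := hC
    have hC0 : 0 ≤ C := (abs_nonneg _).trans (hC 0 0)
    let g : ℕ → ℕ → ℝ := fun i n => ∑' k, B n k * u i k
    have hg1 : ∀ i r (N : Finset ℕ), (∀ n ∈ N, r ≤ n) → |∑ n ∈ N, g i n| ≤ Q r * C := by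
      intro i r N hN
      simp only [g]
      rw [hgN _ (hu i)]
      have hs : Summable (fun k => |(∑ n ∈ N, B n k) * u i k|) := by
        refine Summable.of_nonneg_of_le (fun _ => abs_nonneg _) (fun k => ?_) ((hbN N).mul_right C)
        rw [abs_mul]
        exact mul_le_mul_of_nonneg_left (hC i k) (abs_nonneg _)
      have h1 : |∑' k, (∑ n ∈ N, B n k) * u i k| ≤ ∑' k, |(∑ n ∈ N, B n k) * u i k| :=
        norm_tsum_le_tsum_norm (f := fun k => (∑ n ∈ N, B n k) * u i k) hs
      refine h1.trans ?_
      refine le_trans ?_ (mul_le_mul_of_nonneg_right (hQle r N hN) hC0)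
      rw [← tsum_mul_right]
      refine Summable.tsum_le_tsum (fun k => ?_) hs ((hbN N).mul_right C)
      rw [abs_mul]
      exact mul_le_mul_of_nonneg_left (hC i k) (abs_nonneg _)
    have hg2 : ∀ i r (N : Finset ℕ), (∀ n ∈ N, r ≤ n) → ∑ n ∈ N, |g i n| ≤ 2 * (Q r * C) := by
      intro i r N hN
      exact sum_abs_le_two _ _ _ fun t ht => hg1 i r t fun n hn => hN n (ht hn)
    have hcpt : IsCompact (Set.pi Set.univ
        (fun _ : ℕ => Set.Icc (-(Q 0 * C)) (Q 0 * C))) :=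
      isCompact_univ_pi fun _ => isCompact_Icc
    obtain ⟨y, -, φ, hφ, hy⟩ := hcpt.isSeqCompact (x := g) (fun i n _ => by
      have := hg1 i 0 {n} (by simp)
      rw [Finset.sum_singleton] at this
      exact abs_le.1 this)
    rw [tendsto_pi_nhds] at hy
    have hy2 : ∀ r (N : Finset ℕ), (∀ n ∈ N, r ≤ n) → ∑ n ∈ N, |y n| ≤ 2 * (Q r * C) := by
      intro r N hN
      have ht : Tendsto (fun i => ∑ n ∈ N, |g (φ i) n|) atTop (𝓝 (∑ n ∈ N, |y n|)) :=
        tendsto_finsetSum _ fun n _ => (hy n).abs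
      exact le_of_tendsto' ht fun i => hg2 (φ i) r N hN
    have hys : Summable (fun n => |y n|) :=
      summable_of_sum_range_le (c := 2 * (Q 0 * C)) (fun _ => abs_nonneg _)
        fun m => hy2 0 _ (by simp)
    refine ⟨φ, hφ, y, hys, ?_⟩
    change Tendsto (fun i => ∑' n, |g (φ i) n - y n|) atTop (𝓝 0)
    rw [Metric.tendsto_atTop]
    intro ε hε
    have hQC : Tendsto (fun r => 4 * (Q r * C)) atTop (𝓝 0) := by
      simpa using (hlim.mul_const C).const_mul 4
    obtain ⟨r, hr⟩ := (hQC.eventually (gt_mem_nhds (show 0 < ε / 2 by linarith))).exists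
    have hhead : Tendsto (fun i => ∑ n ∈ range r, |g (φ i) n - y n|) atTop (𝓝 0) := by
      have : Tendsto (fun i => ∑ n ∈ range r, |g (φ i) n - y n|) atTop
          (𝓝 (∑ n ∈ range r, |y n - y n|)) :=
        tendsto_finsetSum _ fun n _ => ((hy n).sub tendsto_const_nhds).abs
      simpa using this
    obtain ⟨I, hI⟩ := eventually_atTop.1
      (hhead.eventually (gt_mem_nhds (show 0 < ε / 2 by linarith)))
    refine ⟨I, fun i hi => ?_⟩
    rw [Real.dist_eq, sub_zero, abs_of_nonneg (tsum_nonneg fun _ => abs_nonneg _)]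
    have hle : ∑' n, |g (φ i) n - y n| ≤
        ∑ n ∈ range r, |g (φ i) n - y n| + 4 * (Q r * C) := by
      refine Real.tsum_le_of_sum_range_le (fun _ => abs_nonneg _) fun m => ?_
      have h1 : ∑ n ∈ range m, |g (φ i) n - y n| ≤
          ∑ n ∈ range r, |g (φ i) n - y n| + ∑ n ∈ Ico r m, |g (φ i) n - y n| := by
        rw [← Finset.sum_union (by
          rw [Finset.disjoint_left]; intro i hi hi'; simp at hi hi'; omega)]
        refine Finset.sum_le_sum_of_subset_of_nonneg ?_ (fun _ _ _ => abs_nonneg _)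
        intro i hi; simp at hi ⊢; omega
      have hIco : ∀ n ∈ Ico r m, r ≤ n := fun n hn => (Finset.mem_Ico.1 hn).1
      have h2 : ∑ n ∈ Ico r m, |g (φ i) n - y n| ≤
          ∑ n ∈ Ico r m, |g (φ i) n| + ∑ n ∈ Ico r m, |y n| := by
        rw [← Finset.sum_add_distrib]
        exact Finset.sum_le_sum fun n _ => abs_sub _ _
      have h3 := hg2 (φ i) r _ hIco
      have h4 := hy2 r _ hIco
      linarith
    have := hI i hi
    linarith

/-- Let `X ∈ {c₀(Δ^(α)), ℓ∞(Δ^(α))}` and `A ∈ (X, ℓ₁)`. Then `L_A` is compact iff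
`lim_r ( sup_{N ⊂ ℕ finite, min N ≥ r} ∑_k |∑_{n∈N} â_{nk}| ) = 0`. -/
theorem compact_into_l1 (α : ℝ) (hα : ∀ m : ℤ, α ≠ (m : ℝ))
    (X : Set (ℕ → ℝ))
    (hX : X = {x | memC0Delta α x} ∨ X = {x | memLinfDelta α x})
    (a : ℕ → ℕ → ℝ)
    (hrows : ∀ x ∈ X, ∀ n : ℕ, ∃ L : ℝ, SeriesHasSum (fun k => a n k * x k) L)
    (hmaps : ∀ x ∈ X, Summable (fun n => |matMul a x n|))
    (Ahat : ℕ → ℕ → ℝ)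
    (hAhat : ∀ n k, SeriesHasSum (fun j => fracDelta (-α) (k + j) k * a n (k + j)) (Ahat n k)) :
    (∀ u : ℕ → (ℕ → ℝ), (∀ i, u i ∈ X) → (∃ C : ℝ, ∀ i, deltaNorm α (u i) ≤ C) →
      ∃ φ : ℕ → ℕ, StrictMono φ ∧
        ∃ y : ℕ → ℝ, Summable (fun n => |y n|) ∧
          Tendsto (fun i => ∑' n, |matMul a (u (φ i)) n - y n|) atTop (nhds 0)) ↔
    Tendsto
      (fun r => sSup {t : ℝ | ∃ N : Finset ℕ, (∀ n ∈ N, r ≤ n) ∧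
        t = ∑' k, |∑ n ∈ N, Ahat n k|})
      atTop (nhds 0) := by
  have hα' := neg_nonint α hα
  have hDE : ∀ z, fracDeltaSeq α (fracDeltaSeq (-α) z) = z :=
    fracDeltaSeq_inv α (-α) hα hα' (by ring)
  have hED : ∀ x, fracDeltaSeq (-α) (fracDeltaSeq α x) = x :=
    fracDeltaSeq_inv (-α) α hα' hα (by ring)
  let P : (ℕ → ℝ) → Prop := fun z => fracDeltaSeq (-α) z ∈ X
  have hP0 : ∀ z, Tendsto z atTop (𝓝 0) → P z := by
    intro z hz
    rcases hX with rfl | rfl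
    · change Tendsto (fracDeltaSeq α (fracDeltaSeq (-α) z)) atTop (𝓝 0)
      rwa [hDE]
    · change ∃ C : ℝ, ∀ n, |fracDeltaSeq α (fracDeltaSeq (-α) z) n| ≤ C
      rw [hDE]
      obtain ⟨C, hC⟩ := hz.abs.bddAbove_range
      exact ⟨C, fun n => hC ⟨n, rfl⟩⟩
  have hPy : ∀ z, P z → ∀ y : ℕ → ℝ, (∀ i, |y i| ≤ 1) → P (fun i => z i * y i) := by
    intro z hz y hy
    have hle : ∀ i, |z i * y i| ≤ |z i| := fun i => by
      rw [abs_mul]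
      exact mul_le_of_le_one_right (abs_nonneg _) (hy i)
    rcases hX with rfl | rfl
    · change Tendsto (fracDeltaSeq α (fracDeltaSeq (-α) z)) atTop (𝓝 0) at hz
      change Tendsto (fracDeltaSeq α (fracDeltaSeq (-α) _)) atTop (𝓝 0)
      rw [hDE] at hz ⊢
      have hz' : Tendsto (fun i => |z i|) atTop (𝓝 0) := by simpa using hz.abs
      exact squeeze_zero_norm hle hz'
    · change ∃ C : ℝ, ∀ n, |fracDeltaSeq α (fracDeltaSeq (-α) z) n| ≤ C at hz
      change ∃ C : ℝ, ∀ n, |fracDeltaSeq α (fracDeltaSeq (-α) _) n| ≤ C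
      rw [hDE] at hz ⊢
      obtain ⟨C, hC⟩ := hz
      exact ⟨C, fun n => (hle n).trans (hC n)⟩
  have hXb : ∀ x ∈ X, BddAbove (Set.range fun n => |fracDeltaSeq α x n|) := by
    intro x hx
    rcases hX with rfl | rfl
    · have hx' : Tendsto (fracDeltaSeq α x) atTop (𝓝 0) := hx
      exact hx'.abs.bddAbove_range
    · obtain ⟨C, hC⟩ := hx
      exact ⟨C, by rintro _ ⟨n, rfl⟩; exact hC n⟩
  have hrep : ∀ z, P z → ∀ n, Summable (fun k => |Ahat n k * z k|) ∧
      matMul a (fracDeltaSeq (-α) z) n = ∑' k, Ahat n k * z k := by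
    intro z hz n
    have := row_rep (a n) (-α) (Ahat n) (hAhat n) z (fun y hy => hrows _ (hPy z hz y hy) n)
    exact ⟨this.1, this.2.limUnder_eq⟩
  have hrepf : ∀ z, P z → ∀ n, matMul a (fracDeltaSeq (-α) z) n = ∑' k, Ahat n k * z k :=
    fun z hz n => (hrep z hz n).2
  rw [← core P hP0 Ahat (fun z hz n => (hrep z hz n).1) (fun z hz => by
    have := hmaps _ hz
    simpa only [hrepf z hz] using this)]
  constructor
  · intro h u hu hC
    obtain ⟨C, hC⟩ := hC
    obtain ⟨φ, hφ, y, hy, hlim⟩ := h (fun i => fracDeltaSeq (-α) (u i)) hu ⟨C, fun i => by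
      rw [deltaNorm, hDE]
      exact ciSup_le fun n => hC i n⟩
    refine ⟨φ, hφ, y, hy, ?_⟩
    simpa only [hrepf _ (hu _)] using hlim
  · intro h u hu hC
    obtain ⟨C, hC⟩ := hC
    have hu' : ∀ i, P (fracDeltaSeq α (u i)) := fun i => by
      change fracDeltaSeq (-α) (fracDeltaSeq α (u i)) ∈ X
      rw [hED]; exact hu i
    obtain ⟨φ, hφ, y, hy, hlim⟩ := h (fun i => fracDeltaSeq α (u i)) hu' ⟨C, fun i n =>
      (le_ciSup (hXb _ (hu i)) n).trans (hC i)⟩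
    refine ⟨φ, hφ, y, hy, ?_⟩
    have e : ∀ i n, matMul a (u i) n = ∑' k, Ahat n k * fracDeltaSeq α (u i) k := fun i n => by
      rw [← hrepf _ (hu' i) n, hED]
    simpa only [e] using hlim
end
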